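/- Let (e_1,…,e_n) be an orthonormal basis of V and X, Y ∈ V. Then Σ_{j=1}^n tr(c̄(X)∘c̄(Y)∘c(e_j)∘c̄(X)∘c̄(Y)∘c(e_j)) = n·2^n·(‖X‖²‖Y‖² − 2⟨X,Y⟩²). -/

import Mathlib

open scoped RealInnerProductSpace

noncomputable section

variable {V : Type*} [NormedAddCommGroup V] [InnerProductSpace ℝ V]

/-- Left exterior multiplication `ε(v)` on the exterior algebra `ΛV`. -/
def extMul (v : V) : Module.End ℝ (ExteriorAlgebra ℝ V) :=
  LinearMap.mulLeft ℝ (ExteriorAlgebra.ι ℝ v)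

/-- Interior multiplication (contraction) `ι(v)` on the exterior algebra `ΛV`:
the unique antiderivation with `ι(v) w = ⟪v, w⟫` for `w ∈ V`. -/
def intMul (v : V) : Module.End ℝ (ExteriorAlgebra ℝ V) :=
  CliffordAlgebra.contractLeft (Q := (0 : QuadraticForm ℝ V)) (innerₛₗ ℝ v)

/-- The Clifford action `c(v) = ε(v) - ι(v)`. -/
def cl (v : V) : Module.End ℝ (ExteriorAlgebra ℝ V) := extMul v - intMul v

/-- The Clifford action `c̄(v) = ε(v) + ι(v)`. -/
def clBar (v : V) : Module.End ℝ (ExteriorAlgebra ℝ V) := extMul v + intMul v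

/-- Trace of an endomorphism of `ΛV`. -/
abbrev trΛ : Module.End ℝ (ExteriorAlgebra ℝ V) →ₗ[ℝ] ℝ :=
  LinearMap.trace ℝ (ExteriorAlgebra ℝ V)

theorem extMul_mul_add_swap (v w : V) : extMul v * extMul w + extMul w * extMul v = 0 := by
  refine LinearMap.ext fun x => ?_
  simp only [extMul, LinearMap.add_apply, Module.End.mul_apply, LinearMap.mulLeft_apply,
    ← mul_assoc, ← add_mul, ExteriorAlgebra.ι_add_mul_swap, zero_mul, LinearMap.zero_apply]

theorem intMul_mul_add_swap (v w : V) : intMul v * intMul w + intMul w * intMul v = 0 := by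
  refine LinearMap.ext fun x => ?_
  simp only [intMul, LinearMap.add_apply, Module.End.mul_apply, LinearMap.zero_apply]
  rw [CliffordAlgebra.contractLeft_comm, neg_add_cancel]

theorem intMul_mul_extMul (v w : V) :
    intMul v * extMul w = ⟪v, w⟫ • 1 - extMul w * intMul v := by
  refine LinearMap.ext fun x => ?_
  exact CliffordAlgebra.contractLeft_ι_mul (Q := (0 : QuadraticForm ℝ V)) (innerₛₗ ℝ v) w x

theorem clBar_mul_clBar_swap (v w : V) :
    clBar w * clBar v = (2 * ⟪v, w⟫) • 1 - clBar v * clBar w := by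
  have hE := eq_neg_of_add_eq_zero_left (extMul_mul_add_swap w v)
  have hI := eq_neg_of_add_eq_zero_left (intMul_mul_add_swap w v)
  simp only [clBar, add_mul, mul_add, hE, hI, intMul_mul_extMul, real_inner_comm v w]
  module

theorem cl_mul_clBar_swap (v w : V) : cl w * clBar v = -(clBar v * cl w) := by
  have hE := eq_neg_of_add_eq_zero_left (extMul_mul_add_swap w v)
  have hI := eq_neg_of_add_eq_zero_left (intMul_mul_add_swap w v)
  simp only [cl, clBar, add_mul, mul_add, sub_mul, mul_sub, hE, hI, intMul_mul_extMul,
    real_inner_comm v w]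
  module

theorem clBar_mul_self (v : V) : clBar v * clBar v = (‖v‖ ^ 2) • 1 := by
  have h := clBar_mul_clBar_swap v v
  rw [real_inner_self_eq_norm_sq] at h
  rw [eq_sub_iff_add_eq, ← two_smul ℝ, mul_smul] at h
  exact smul_right_injective _ (two_ne_zero' ℝ) h

theorem cl_mul_self (v : V) : cl v * cl v = -(‖v‖ ^ 2) • 1 := by
  have hE : extMul v * extMul v = 0 := by
    simpa [← two_smul ℝ] using extMul_mul_add_swap v v
  have hI : intMul v * intMul v = 0 := by
    simpa [← two_smul ℝ] using intMul_mul_add_swap v v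
  simp only [cl, sub_mul, mul_sub, hE, hI, intMul_mul_extMul, real_inner_self_eq_norm_sq]
  module

theorem trΛ_one {n : ℕ} (b : Module.Basis (Fin n) ℝ V) :
    trΛ (1 : Module.End ℝ (ExteriorAlgebra ℝ V)) = 2 ^ n := by
  have := Module.Finite.of_basis b.ExteriorAlgebra
  have := Module.Free.of_basis b.ExteriorAlgebra
  rw [trΛ, LinearMap.trace_one, Module.finrank_eq_card_basis b.ExteriorAlgebra]
  simp

theorem trΛ_clBar_mul_clBar {n : ℕ} (b : Module.Basis (Fin n) ℝ V) (v w : V) :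
    trΛ (clBar v * clBar w) = ⟪v, w⟫ * 2 ^ n := by
  have h := congrArg trΛ (clBar_mul_clBar_swap v w)
  rw [map_sub, map_smul, trΛ_one b, LinearMap.trace_mul_comm, smul_eq_mul] at h
  linarith

theorem clBar_mul_clBar_sq (v w : V) :
    clBar v * clBar w * (clBar v * clBar w) =
      (2 * ⟪v, w⟫) • (clBar v * clBar w) - (‖v‖ ^ 2 * ‖w‖ ^ 2) • 1 := by
  calc clBar v * clBar w * (clBar v * clBar w)
      = clBar v * (clBar w * clBar v) * clBar w := by simp only [mul_assoc]
    _ = (2 * ⟪v, w⟫) • (clBar v * clBar w) - clBar v * clBar v * (clBar w * clBar w) := by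
      rw [clBar_mul_clBar_swap]
      simp only [mul_sub, sub_mul, mul_smul_comm, smul_mul_assoc, mul_one, mul_assoc]
    _ = _ := by
      rw [clBar_mul_self, clBar_mul_self, smul_mul_smul_comm, mul_one]

theorem clBar_mul_clBar_mul_cl_sq (v w u : V) :
    clBar v * clBar w * cl u * (clBar v * clBar w * cl u) =
      (‖u‖ ^ 2) • ((‖v‖ ^ 2 * ‖w‖ ^ 2) • 1 - (2 * ⟪v, w⟫) • (clBar v * clBar w)) := by
  have hcomm : cl u * (clBar v * clBar w) = clBar v * clBar w * cl u := by
    calc cl u * (clBar v * clBar w)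
        = -(clBar v * cl u) * clBar w := by rw [← mul_assoc, cl_mul_clBar_swap]
      _ = -(clBar v * (cl u * clBar w)) :=
        (neg_mul (clBar v * cl u) (clBar w)).trans (by rw [mul_assoc])
      _ = clBar v * -(cl u * clBar w) := (mul_neg (clBar v) (cl u * clBar w)).symm
      _ = clBar v * clBar w * cl u := by rw [cl_mul_clBar_swap, neg_neg, mul_assoc]
  calc clBar v * clBar w * cl u * (clBar v * clBar w * cl u)
      = clBar v * clBar w * (cl u * (clBar v * clBar w)) * cl u := by simp only [mul_assoc]
    _ = clBar v * clBar w * (clBar v * clBar w) * (cl u * cl u) := by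
      rw [hcomm]; simp only [mul_assoc]
    _ = _ := by
      rw [clBar_mul_clBar_sq, cl_mul_self, mul_smul_comm, mul_one]
      module

theorem trace_sum_cbarcbar_XYj [FiniteDimensional ℝ V] (n : ℕ)
    (e : OrthonormalBasis (Fin n) ℝ V) (X Y : V) :
    ∑ j : Fin n,
        trΛ (clBar X ∘ₗ clBar Y ∘ₗ cl (e j) ∘ₗ clBar X ∘ₗ clBar Y ∘ₗ cl (e j))
      = (n : ℝ) * 2 ^ n * (‖X‖ ^ 2 * ‖Y‖ ^ 2 - 2 * ⟪X, Y⟫ ^ 2) := by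
  have h (j : Fin n) :
      trΛ (clBar X ∘ₗ clBar Y ∘ₗ cl (e j) ∘ₗ clBar X ∘ₗ clBar Y ∘ₗ cl (e j))
        = 2 ^ n * (‖X‖ ^ 2 * ‖Y‖ ^ 2 - 2 * ⟪X, Y⟫ ^ 2) := by
    have hsq := congrArg trΛ (clBar_mul_clBar_mul_cl_sq X Y (e j))
    rw [e.norm_eq_one, one_pow, one_smul, map_sub, map_smul, map_smul, trΛ_one e.toBasis,
      trΛ_clBar_mul_clBar e.toBasis, smul_eq_mul, smul_eq_mul] at hsq
    simp only [← Module.End.mul_eq_comp]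
    simp only [mul_assoc] at hsq ⊢
    rw [hsq]
    ring
  simp only [h, Finset.sum_const, Finset.card_univ, Fintype.card_fin, nsmul_eq_mul, mul_assoc]
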